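/- arXiv:2303.10281 — 6 statements merged into one kernel-verified Lean document; each statement's English description precedes it below -/
import Mathlib

section
/- Let n ≥ 3 be an integer and let P_n be the prism graph of order 2n, i.e. the box product (Cartesian product) of the cycle graph C_n with the complete graph K_2. Then the set of real numbers r such that P_n admits a complex nowhere-zero r-flow has a least element, equal to: 2 if n is even; 1 + 2·sin((π/6)·(n/(n-1))) if n ≡ 1 or n ≡ 3 (mod 6); and 1 + 2·sin((π/6)·((n+1)/n)) if n ≡ 5 (mod 6). -/
open Real SimpleGraph

/-- A complex nowhere-zero `r`-flow on a finite simple graph `G`. -/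
def HasComplexNZFlow {V : Type*} [Fintype V] [DecidableEq V]
    (G : SimpleGraph V) [DecidableRel G.Adj] (r : ℝ) : Prop :=
  ∃ f : G.Dart → ℂ,
    (∀ d : G.Dart, f d.symm = -f d) ∧
    (∀ v : V, ∑ d ∈ Finset.univ.filter (fun d : G.Dart => d.fst = v), f d = 0) ∧
    (∀ d : G.Dart, 1 ≤ ‖f d‖ ∧ ‖f d‖ ≤ r - 1)


lemma four_mul_sin_sq_add_sub_one_le {u v : ℝ} (hu : 0 ≤ u) (hv : 0 ≤ v) (hu' : u ≤ π / 12)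
    (hv' : v ≤ π / 12) :
    4 * sin (π / 6 + u) ^ 2 + 4 * sin (π / 6 + v) ^ 2 - 1 ≤
      8 * sin (π / 6 + u) * sin (π / 6 + v) * cos (π / 3 - (u + v)) := by
  have hpi := pi_pos
  have key : 8 * sin (π / 6 + u) * sin (π / 6 + v) * cos (π / 3 - (u + v)) -
      (4 * sin (π / 6 + u) ^ 2 + 4 * sin (π / 6 + v) ^ 2 - 1) =
      8 * (cos (u + v) * (sin u * sin v)) := by
    simp only [sin_add, cos_add, cos_sub, cos_pi_div_six, sin_pi_div_six, cos_pi_div_three,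
      sin_pi_div_three]
    have h3 : √3 ^ 2 = 3 := by norm_num
    have h1 := sin_sq_add_cos_sq u
    have h2 := sin_sq_add_cos_sq v
    grind
  have : 0 ≤ cos (u + v) * (sin u * sin v) :=
    mul_nonneg (cos_nonneg_of_mem_Icc ⟨by linarith, by linarith⟩)
      (mul_nonneg (sin_nonneg_of_nonneg_of_le_pi hu (by linarith))
        (sin_nonneg_of_nonneg_of_le_pi hv (by linarith)))
  linarith

lemma eight_mul_sin_mul_sin_mul_cos_le {d u v : ℝ} (hu : 0 ≤ u) (hv : 0 ≤ v) (hu' : u ≤ d)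
    (hv' : v ≤ d)
    (hd : d ≤ π / 12) :
    8 * sin (π / 6 + u) * sin (π / 6 + v) * cos (π / 3 + 2 * d - (u + v)) ≤
      4 * sin (π / 6 + u) ^ 2 + 4 * sin (π / 6 + v) ^ 2 - 4 * sin (π / 6 + d) ^ 2 := by
  have hpi := pi_pos
  have key : 4 * sin (π / 6 + u) ^ 2 + 4 * sin (π / 6 + v) ^ 2 - 4 * sin (π / 6 + d) ^ 2 -
      8 * sin (π / 6 + u) * sin (π / 6 + v) * cos (π / 3 + 2 * d - (u + v)) =
      4 * (cos (u + v - d) - cos d) * (cos (u + v - d) + cos d - 2 * cos (π / 3 + d)) +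
      8 * cos (π / 3 + d) * (cos (u + v - d) * (1 - cos (u - v))) := by
    simp only [sin_add, cos_add, cos_sub, cos_pi_div_six, sin_pi_div_six, cos_pi_div_three,
      sin_pi_div_three, cos_two_mul, sin_two_mul]
    have h3 : √3 ^ 2 = 3 := by norm_num
    have h1 := sin_sq_add_cos_sq u
    have h2 := sin_sq_add_cos_sq v
    have h4 := sin_sq_add_cos_sq d
    grind
  have hC : cos d ≤ cos (u + v - d) := by
    rw [← cos_abs (u + v - d)]
    exact cos_le_cos_of_nonneg_of_le_pi (abs_nonneg _) (by linarith)
      (abs_le.2 ⟨by linarith, by linarith⟩)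
  have hc : cos (π / 3 + d) ≤ cos d :=
    cos_le_cos_of_nonneg_of_le_pi (by linarith) (by linarith) (by linarith)
  have hc0 : 0 ≤ cos (π / 3 + d) := cos_nonneg_of_mem_Icc ⟨by linarith, by linarith⟩
  have h1 : 0 ≤ 4 * (cos (u + v - d) - cos d) *
      (cos (u + v - d) + cos d - 2 * cos (π / 3 + d)) :=
    mul_nonneg (by linarith) (by linarith)
  have h2 : 0 ≤ 8 * cos (π / 3 + d) * (cos (u + v - d) * (1 - cos (u - v))) :=
    mul_nonneg (by linarith) (mul_nonneg (by linarith) (by linarith [cos_le_one (u - v)]))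
  linarith

lemma four_mul_sin_mul_sin_le_one {x : ℝ} (hx : 7 ≤ x) :
    4 * sin (π / 6 * (x / (x - 1))) * sin (π / 6 * ((x - 1) / x)) ≤ 1 := by
  have hpi := pi_gt_d2
  have hpi' := pi_lt_d2
  set p := π / 6 * (x / (x - 1)) with hp
  set q := π / 6 * ((x - 1) / x) with hq
  have hx1 : 0 < x - 1 := by linarith
  have hpq : p * q = (π / 6) ^ 2 := by rw [hp, hq]; field_simp
  have hp1 : π / 6 ≤ p := by
    rw [hp]; exact le_mul_of_one_le_right (by positivity) ((one_le_div hx1).2 (by linarith))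
  have hp2 : p ≤ π / 6 * (7 / 6) := by
    exact mul_le_mul_of_nonneg_left ((div_le_iff₀ hx1).2 (by linarith)) (by positivity)
  have hq1 : π / 6 * (6 / 7) ≤ q := by
    exact mul_le_mul_of_nonneg_left ((le_div_iff₀ (by linarith)).2 (by linarith)) (by positivity)
  have hq2 : q ≤ π / 6 := by
    rw [hq]
    exact mul_le_of_le_one_right (by positivity) ((div_le_one (by linarith)).2 (by linarith))
  set s := (p + q) / 2 with hs
  set d := (p - q) / 2 with hd
  have hst : d ^ 2 = (s - π / 6) * (s + π / 6) := by rw [hd, hs]; linear_combination -hpq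
  have hsq : s ≥ π / 6 := by nlinarith [sq_nonneg d]
  have e1 : sin p * sin q = sin s ^ 2 - sin d ^ 2 := by
    have h1 : p = s + d := by rw [hs, hd]; ring
    have h2 : q = s - d := by rw [hs, hd]; ring
    rw [h1, h2, sin_add, sin_sub]
    linear_combination sin s ^ 2 * sin_sq_add_cos_sq d - sin d ^ 2 * sin_sq_add_cos_sq s
  have e2 : sin s ^ 2 - 1 / 4 = sin (s - π / 6) * sin (s + π / 6) := by
    rw [sin_add, sin_sub, cos_pi_div_six, sin_pi_div_six]
    have h3 : √3 ^ 2 = 3 := by norm_num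
    linear_combination 1 / 4 * sin_sq_add_cos_sq s - sin s ^ 2 / 4 * h3
  have h1 : sin (s - π / 6) * sin (s + π / 6) ≤ s - π / 6 := by
    have h2 := sin_le (x := s - π / 6) (by linarith)
    have h3 := sin_nonneg_of_nonneg_of_le_pi (x := s - π / 6) (by linarith) (by linarith)
    nlinarith [sin_le_one (s + π / 6)]
  have hd0 : 0 ≤ d := by linarith
  have hd1 : d ≤ 1 / 10 := by linarith
  have h2 : 0.97 * d ^ 2 ≤ sin d ^ 2 := by
    rcases hd0.eq_or_lt with h | h
    · simp [← h]
    · have h3 := sin_gt_sub_cube h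
      have h4 : 0.99 * d ≤ sin d := by nlinarith
      nlinarith
  have h3 : s - π / 6 ≤ 0.97 * d ^ 2 := by rw [hst]; nlinarith
  nlinarith

open InnerProductGeometry in
/-- In a triangle with side lengths in `[1, 2 * sin (π / 6 + d)]`, the deviation of an angle from
`π / 3` is controlled by a sum of contributions of its two adjacent sides. -/
lemma angle_mem_of_norm_eq_two_mul_sin {d u v : ℝ} (hu : 0 ≤ u) (hv : 0 ≤ v) (hu' : u ≤ d)
    (hv' : v ≤ d)
    (hd : d ≤ π / 12) {z w : ℂ} (hz : ‖z‖ = 2 * sin (π / 6 + u))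
    (hw : ‖w‖ = 2 * sin (π / 6 + v)) (h1 : 1 ≤ ‖z - w‖) (h2 : ‖z - w‖ ≤ 2 * sin (π / 6 + d)) :
    π / 3 - (u + v) ≤ angle z w ∧ angle z w ≤ π / 3 + 2 * d - (u + v) := by
  have hpi := pi_pos
  have law := norm_sub_sq_eq_norm_sq_add_norm_sq_sub_two_mul_norm_mul_norm_mul_cos_angle z w
  have hsu : 0 < sin (π / 6 + u) := sin_pos_of_pos_of_lt_pi (by linarith) (by linarith)
  have hsv : 0 < sin (π / 6 + v) := sin_pos_of_pos_of_lt_pi (by linarith) (by linarith)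
  have hsuv := mul_pos hsu hsv
  rw [hz, hw] at law
  constructor <;> by_contra! hlt
  · have hcos := cos_lt_cos_of_nonneg_of_le_pi (angle_nonneg z w) (by linarith) hlt
    have := four_mul_sin_sq_add_sub_one_le hu hv (hu'.trans hd) (hv'.trans hd)
    nlinarith [mul_lt_mul_of_pos_left hcos hsuv]
  · have hcos := cos_lt_cos_of_nonneg_of_le_pi (by linarith) (angle_le_pi z w) hlt
    have := eight_mul_sin_mul_sin_mul_cos_le hu hv hu' hv' hd
    nlinarith [mul_lt_mul_of_pos_left hcos hsuv]

open InnerProductGeometry in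
lemma cos_angle_le {R : ℝ} (hR : R ≤ 3 / 2) {z w : ℂ} (hz : 1 ≤ ‖z‖) (hw : 1 ≤ ‖w‖)
    (hz' : ‖z‖ ≤ R) (hw' : ‖w‖ ≤ R) (h : 1 ≤ ‖z - w‖) :
    2 * R ^ 2 * cos (angle z w) ≤ 2 * R ^ 2 - 1 := by
  wlog hwz : ‖w‖ ≤ ‖z‖ generalizing z w
  · rw [angle_comm]
    exact this hw hz hw' hz' (by rwa [norm_sub_rev]) (le_of_not_ge hwz)
  have law := norm_sub_sq_eq_norm_sq_add_norm_sq_sub_two_mul_norm_mul_norm_mul_cos_angle z w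
  set x := ‖z‖
  set y := ‖w‖
  set c := cos (angle z w)
  have hxy : 0 < x * y := by positivity
  have h1 : 2 * (x * y) * c ≤ x ^ 2 + y ^ 2 - 1 := by nlinarith
  have h2 : (x - y) * R ^ 2 ≤ x := by
    have hR1 : 1 ≤ R := hz.trans hz'
    nlinarith [mul_le_mul_of_nonneg_right hw (sq_nonneg R),
      mul_le_mul_of_nonneg_left hz' (by nlinarith : 0 ≤ R ^ 2 - 1),
      mul_nonneg (by linarith : 0 ≤ R) (by nlinarith : 0 ≤ 1 + R - R ^ 2)]
  have h3 : (x - y) ^ 2 * R ^ 2 + x * y ≤ R ^ 2 := by nlinarith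
  refine le_of_mul_le_mul_left ?_ hxy
  nlinarith

lemma exists_sum_arg_div_eq {n : ℕ} [NeZero n] {a : Fin n → ℂ} (ha : ∀ i, a i ≠ 0) :
    ∃ k : ℤ, ∑ i, (a (i + 1) / a i).arg = 2 * π * k := by
  have hprod : ∏ i, a (i + 1) / a i = 1 := by
    rw [Finset.prod_div_distrib,
      show ∏ i, a (i + 1) = ∏ i, a i from Equiv.prod_comp (Equiv.addRight 1) a]
    exact div_self (Finset.prod_ne_zero_iff.2 fun i _ => ha i)
  have hexp : Complex.exp (∑ i, Complex.log (a (i + 1) / a i)) = 1 := by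
    rw [Complex.exp_sum, ← hprod]
    exact Finset.prod_congr rfl fun i _ => Complex.exp_log (div_ne_zero (ha _) (ha i))
  obtain ⟨k, hk⟩ := Complex.exp_eq_one_iff.1 hexp
  refine ⟨k, ?_⟩
  have := congrArg Complex.im hk
  simp only [Complex.im_sum, Complex.log_im] at this
  rw [this]
  simp
  ring

lemma two_le_card_ne_succ {n : ℕ} [NeZero n] {s : Fin n → ℤ} {i : Fin n} (hi : s (i + 1) ≠ s i) :
    2 ≤ (Finset.univ.filter fun j => s (j + 1) ≠ s j).card := by
  have hsum : ∑ j, (s (j + 1) - s j) = 0 := by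
    rw [Finset.sum_sub_distrib,
      show ∑ j, s (j + 1) = ∑ j, s j from Equiv.sum_comp (Equiv.addRight 1) s, sub_self]
  by_contra! hcard
  have huniq : ∀ j, j ≠ i → s (j + 1) - s j = 0 := by
    intro j hj
    by_contra hne
    exact hj (Finset.card_le_one.1 (Nat.le_of_lt_succ hcard) j (by simpa [sub_eq_zero] using hne)
      i (by simpa using hi))
  rw [Finset.sum_eq_single i (fun j _ => huniq j) (by simp)] at hsum
  exact hi (sub_eq_zero.1 hsum)

lemma sum_sign_mul_le {n : ℕ} [NeZero n] {s : Fin n → ℤ} (hs : ∀ i, s i = 1 ∨ s i = -1)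
    {d : ℝ} {u e : Fin n → ℝ} (hu : ∀ i, 0 ≤ u i) (hud : ∀ i, u i ≤ d)
    (he : ∀ i, -(u i + u (i + 1)) ≤ e i) (he' : ∀ i, e i ≤ 2 * d - (u i + u (i + 1)))
    {i : Fin n} (hi : s (i + 1) ≠ s i) :
    ∑ j, s j * e j ≤ 2 * d * (n - 1) := by
  have hd : 0 ≤ d := (hu 0).trans (hud 0)
  calc ∑ j, s j * e j
      ≤ ∑ j, (d + (s j * (d / 2 - u (j + 1)) + s j * (d / 2 - u j))) := by
        refine Finset.sum_le_sum fun j _ => ?_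
        rcases hs j with h | h <;> rw [h] <;> push_cast <;> linarith [he j, he' j]
    _ = ∑ j, (d + (s j * (d / 2 - u (j + 1)) + s (j + 1) * (d / 2 - u (j + 1)))) := by
        simp only [Finset.sum_add_distrib]
        congr 2
        exact (Equiv.sum_comp (Equiv.addRight 1) fun j => (s j : ℝ) * (d / 2 - u j)).symm
    _ ≤ ∑ j, (2 * d - d * if s (j + 1) ≠ s j then 1 else 0) := by
        refine Finset.sum_le_sum fun j _ => ?_
        have h1 := hu (j + 1)
        have h2 := hud (j + 1)
        rcases hs j with h | h <;> rcases hs (j + 1) with h' | h' <;> rw [h, h'] <;>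
          norm_num <;> linarith
    _ = 2 * d * n - d * (Finset.univ.filter fun j => s (j + 1) ≠ s j).card := by
        rw [Finset.sum_sub_distrib, ← Finset.mul_sum _ _ d, Finset.sum_boole]
        simp
        ring
    _ ≤ 2 * d * (n - 1) := by
        have : (2 : ℝ) ≤ (Finset.univ.filter fun j => s (j + 1) ≠ s j).card := by
          exact_mod_cast two_le_card_ne_succ hi
        nlinarith

lemma eq_apply_zero_of_succ_eq {n : ℕ} [NeZero n] {α : Type*} {s : Fin n → α}
    (h : ∀ i, s (i + 1) = s i) (i : Fin n) : s i = s 0 := by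
  obtain ⟨m, rfl⟩ := Nat.exists_eq_succ_of_ne_zero (NeZero.ne n)
  induction i using Fin.induction with
  | zero => rfl
  | succ i ih => rw [← Fin.coeSucc_eq_succ, h, ih]

lemma sum_darts_fst_eq {V : Type*} [Fintype V] [DecidableEq V] {G : SimpleGraph V}
    [DecidableRel G.Adj] {M : Type*} [AddCommMonoid M] (f : G.Dart → M) {v x y z : V}
    (hx : G.Adj v x) (hy : G.Adj v y) (hz : G.Adj v z) (hxy : x ≠ y) (hxz : x ≠ z) (hyz : y ≠ z)
    (hv : ∀ w, G.Adj v w → w = x ∨ w = y ∨ w = z) :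
    ∑ d ∈ Finset.univ.filter (fun d : G.Dart => d.fst = v), f d =
      f ⟨(v, x), hx⟩ + f ⟨(v, y), hy⟩ + f ⟨(v, z), hz⟩ := by
  have : Finset.univ.filter (fun d : G.Dart => d.fst = v) =
      {⟨(v, x), hx⟩, ⟨(v, y), hy⟩, ⟨(v, z), hz⟩} := by
    ext ⟨⟨p, q⟩, hpq⟩
    simp only [Finset.mem_filter, Finset.mem_univ, true_and, Finset.mem_insert,
      Finset.mem_singleton, Dart.ext_iff, Prod.ext_iff]
    constructor
    · rintro rfl
      simpa using hv q hpq
    · rintro (h | h | h) <;> exact h.1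
  rw [this, Finset.sum_insert, Finset.sum_insert, Finset.sum_singleton, add_assoc]
  · simpa using hyz
  · simp [hxy, hxz]

lemma cycleGraph_adj_iff {n : ℕ} [NeZero n] (hn : 2 ≤ n) {i j : Fin n} :
    (cycleGraph n).Adj i j ↔ j = i + 1 ∨ i = j + 1 := by
  have h (k l : Fin n) : (k - l).val = 1 ↔ k = l + 1 := by
    rw [← sub_eq_iff_eq_add', Fin.ext_iff, Fin.val_one', Nat.mod_eq_of_lt (by omega)]
  rw [cycleGraph_adj', h, h, or_comm]

lemma add_one_ne_sub_one {n : ℕ} [NeZero n] (hn : 3 ≤ n) (i : Fin n) : i + 1 ≠ i - 1 := by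
  intro h
  rw [eq_sub_iff_add_eq, add_assoc, add_eq_left] at h
  have := congrArg Fin.val h
  rw [Fin.val_add, Fin.val_one', Nat.mod_eq_of_lt (by omega : 1 < n)] at this
  rw [Nat.mod_eq_of_lt (by omega)] at this
  simp at this

/-- The prism graph on `2 * n` vertices. -/
abbrev prismGraph (n : ℕ) : SimpleGraph (Fin n × Fin 2) :=
  (cycleGraph n).boxProd (completeGraph (Fin 2))

/-- A cyclic sequence of complex numbers whose moduli and whose consecutive distances all lie in
`[1, R]`. -/
def IsAnnularWalk {n : ℕ} [NeZero n] (R : ℝ) (a : Fin n → ℂ) : Prop :=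
  ∀ i, (1 ≤ ‖a i‖ ∧ ‖a i‖ ≤ R) ∧ 1 ≤ ‖a (i + 1) - a i‖ ∧ ‖a (i + 1) - a i‖ ≤ R

lemma hasComplexNZFlow_prismGraph_iff {n : ℕ} [NeZero n] (hn : 3 ≤ n) {r : ℝ}
    [DecidableEq (Fin n × Fin 2)] [DecidableRel (prismGraph n).Adj] :
    HasComplexNZFlow (prismGraph n) r ↔
      ∃ a : Fin n → ℂ, IsAnnularWalk (r - 1) a := by
  have hadj (i j : Fin n) (s t : Fin 2) :
      (prismGraph n).Adj (i, s) (j, t) ↔ (j = i + 1 ∨ i = j + 1) ∧ s = t ∨ s ≠ t ∧ i = j := by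
    rw [boxProd_adj, cycleGraph_adj_iff (by omega)]
    rfl
  have hnext (i : Fin n) (s : Fin 2) : (prismGraph n).Adj (i, s) (i + 1, s) :=
    (hadj _ _ _ _).2 (by simp)
  have hprev (i : Fin n) (s : Fin 2) : (prismGraph n).Adj (i, s) (i - 1, s) :=
    (hadj _ _ _ _).2 (by simp)
  have hspoke (i : Fin n) (s : Fin 2) : (prismGraph n).Adj (i, s) (i, s + 1) := by simp
  have hsum (f : (prismGraph n).Dart → ℂ) (i : Fin n) (s : Fin 2) :
      ∑ d ∈ Finset.univ.filter (fun d : (prismGraph n).Dart => d.fst = (i, s)), f d =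
        f ⟨(_, _), hnext i s⟩ + f ⟨(_, _), hprev i s⟩ + f ⟨(_, _), hspoke i s⟩ := by
    refine sum_darts_fst_eq f _ _ _ (by simpa using add_one_ne_sub_one hn i) (by simp) (by simp) ?_
    rintro ⟨j, t⟩ h
    rw [hadj] at h
    rcases h with ⟨rfl | rfl, rfl⟩ | ⟨hst, rfl⟩
    · simp
    · simp
    · have : t = s + 1 := by revert hst; revert s t; decide
      simp [this]
  constructor
  · rintro ⟨f, hsymm, hflow, hnorm⟩
    refine ⟨fun i => f ⟨(_, _), hnext i 0⟩, fun i => ⟨hnorm _, ?_⟩⟩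
    have h1 := hflow (i + 1, 0)
    rw [hsum] at h1
    have h2 : f ⟨(_, _), hprev (i + 1) 0⟩ = -f ⟨(_, _), hnext i 0⟩ := by
      rw [← hsymm]
      congr 1
      simp [Dart.symm]
    rw [show f ⟨(_, _), hnext (i + 1) 0⟩ - f ⟨(_, _), hnext i 0⟩ = -f ⟨(_, _), hspoke (i + 1) 0⟩ by
      linear_combination h1 - h2, norm_neg]
    exact hnorm _
  · rintro ⟨a, ha⟩
    let F (p q : Fin n × Fin 2) : ℂ := (if p.2 = 0 then 1 else -1) *
      if p.2 = q.2 then if q.1 = p.1 + 1 then a p.1 else -a q.1 else a (p.1 - 1) - a p.1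
    have hF : ∀ p q, (prismGraph n).Adj p q → F q p = -F p q := by
      rintro ⟨i, s⟩ ⟨j, t⟩ h
      rw [hadj] at h
      have h2 (k : Fin n) : k ≠ k + 1 + 1 := fun h =>
        add_one_ne_sub_one hn (k + 1) (by rw [← h, add_sub_cancel_right])
      rcases h with ⟨rfl | rfl, rfl⟩ | ⟨hst, rfl⟩
      · simp [F, h2]
      · simp [F, h2]
      · fin_cases s <;> fin_cases t <;> simp_all [F]
    refine ⟨fun d => F d.fst d.snd, fun d => hF _ _ d.adj, ?_, ?_⟩
    · rintro ⟨i, s⟩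
      rw [hsum]
      have h1 : i - 1 ≠ i + 1 := (add_one_ne_sub_one hn i).symm
      have h2 : s ≠ s + 1 := by simp
      simp only [F, h1, h2, if_true, if_false]
      ring
    · rintro ⟨⟨⟨i, s⟩, ⟨j, t⟩⟩, h⟩
      have hsign : ‖(if s = 0 then 1 else -1 : ℂ)‖ = 1 := by split_ifs <;> simp
      simp only [F, norm_mul, hsign, one_mul]
      split_ifs with h1 h2
      · exact (ha i).1
      · rw [norm_neg]
        exact (ha j).1
      · have := (ha (i - 1)).2
        rwa [sub_add_cancel, norm_sub_rev] at this

open InnerProductGeometry in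
/-- The signs of the turning angles of an annular walk, together with the deviations `e` of their
absolute values from `π / 3`; the walk winds `k` times around the origin. -/
lemma IsAnnularWalk.exists_signs {n : ℕ} [NeZero n] {d : ℝ} (hd0 : 0 ≤ d) (hd : d ≤ π / 12)
    {a : Fin n → ℂ} (ha : IsAnnularWalk (2 * sin (π / 6 + d)) a) :
    ∃ (s : Fin n → ℤ) (u e : Fin n → ℝ) (k : ℤ), (∀ i, s i = 1 ∨ s i = -1) ∧
      (∀ i, 0 ≤ u i) ∧ (∀ i, u i ≤ d) ∧
      (∀ i, -(u i + u (i + 1)) ≤ e i) ∧ (∀ i, e i ≤ 2 * d - (u i + u (i + 1))) ∧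
      (∀ i, angle (a (i + 1)) (a i) = π / 3 + e i) ∧
      ∑ i, s i * e i = π / 3 * (6 * k - ∑ i, s i : ℤ) := by
  have hpi := pi_pos
  have hne (i) : a i ≠ 0 := norm_pos_iff.1 (zero_lt_one.trans_le (ha i).1.1)
  obtain ⟨k, hk⟩ := exists_sum_arg_div_eq hne
  let u (i : Fin n) : ℝ := arcsin (‖a i‖ / 2) - π / 6
  have hR : arcsin (sin (π / 6 + d)) = π / 6 + d := arcsin_sin (by linarith) (by linarith)
  have hR1 := sin_le_one (π / 6 + d)
  have hu0 (i) : 0 ≤ u i := by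
    have h := monotone_arcsin (by linarith [(ha i).1.1] : (1 / 2 : ℝ) ≤ ‖a i‖ / 2)
    rw [← sin_pi_div_six, arcsin_sin (by linarith) (by linarith)] at h
    exact sub_nonneg.2 h
  have hud (i) : u i ≤ d := by
    have h := monotone_arcsin (by linarith [(ha i).1.2] : ‖a i‖ / 2 ≤ sin (π / 6 + d))
    rw [hR] at h
    simp only [u]
    linarith
  have hnorm (i) : ‖a i‖ = 2 * sin (π / 6 + u i) := by
    simp only [u, add_sub_cancel]
    rw [sin_arcsin (by linarith [norm_nonneg (a i)]) (by linarith [(ha i).1.2])]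
    ring
  have hang (i) := angle_mem_of_norm_eq_two_mul_sin (hu0 (i + 1)) (hu0 i) (hud _) (hud _)
    hd (hnorm _) (hnorm _)
    (ha i).2.1 (ha i).2.2
  let s (i : Fin n) : ℤ := if 0 ≤ (a (i + 1) / a i).arg then 1 else -1
  have hs (i) : (s i : ℝ) * angle (a (i + 1)) (a i) = (a (i + 1) / a i).arg := by
    rw [Complex.angle_eq_abs_arg (hne _) (hne _)]
    simp only [s]
    split_ifs with h
    · simp [abs_of_nonneg h]
    · simp [abs_of_neg (not_le.1 h)]
  refine ⟨s, u, fun i => angle (a (i + 1)) (a i) - π / 3, k, fun i => ?_, hu0, hud,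
    fun i => by linarith [hang i], fun i => by linarith [hang i], fun i => by ring, ?_⟩
  · simp only [s]
    split_ifs <;> simp
  · simp only [mul_sub, hs, Finset.sum_sub_distrib, hk, ← Finset.sum_mul]
    push_cast
    ring

lemma odd_sum_of_forall_eq_one_or_neg_one {n : ℕ} (hn : Odd n) {s : Fin n → ℤ}
    (hs : ∀ i, s i = 1 ∨ s i = -1) : Odd (∑ i, s i) := by
  have h : (2 : ℤ) ∣ ∑ i, (s i - 1) := Finset.dvd_sum fun i _ => by
    rcases hs i with h | h <;> rw [h] <;> decide
  rw [Finset.sum_sub_distrib] at h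
  simp only [Finset.sum_const, Finset.card_univ, Fintype.card_fin, nsmul_eq_mul, mul_one] at h
  rw [Int.odd_iff]
  rw [Nat.odd_iff] at hn
  omega

lemma one_le_abs_of_odd {m : ℤ} (hm : Odd m) : (1 : ℝ) ≤ |(m : ℝ)| := by
  have : 1 ≤ |m| := Int.one_le_abs (by rintro rfl; simp at hm)
  exact_mod_cast this

lemma abs_sum_sign_mul_le {n : ℕ} {s : Fin n → ℤ} (hs : ∀ i, s i = 1 ∨ s i = -1)
    {d : ℝ} {e : Fin n → ℝ} (he : ∀ i, |e i| ≤ 2 * d) : |∑ i, s i * e i| ≤ 2 * d * n := by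
  calc |∑ i, s i * e i| ≤ ∑ i, |s i * e i| := Finset.abs_sum_le_sum_abs _ _
    _ ≤ ∑ _i : Fin n, 2 * d := by
        refine Finset.sum_le_sum fun i _ => ?_
        rcases hs i with h | h <;> simpa [h] using he i
    _ = 2 * d * n := by
        simp
        ring

lemma IsAnnularWalk.pi_le_of_odd {n : ℕ} [NeZero n] (hn : Odd n) {d : ℝ} (hd0 : 0 ≤ d)
    (hd : d ≤ π / 12) {a : Fin n → ℂ} (ha : IsAnnularWalk (2 * sin (π / 6 + d)) a) :
    π ≤ 6 * d * n := by
  obtain ⟨s, u, e, k, hs, hu0, hud, he, he', -, hsum⟩ := ha.exists_signs hd0 hd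
  have h := abs_sum_sign_mul_le hs (e := e) (d := d)
    fun i => abs_le.2 ⟨by linarith [he i, hud i, hud (i + 1)],
      by linarith [he' i, hu0 i, hu0 (i + 1)]⟩
  have hodd : Odd (6 * k - ∑ i, s i) :=
    ((by decide : Even (6 : ℤ)).mul_right k).sub_odd (odd_sum_of_forall_eq_one_or_neg_one hn hs)
  rw [hsum, abs_mul, abs_of_pos (by positivity)] at h
  nlinarith [one_le_abs_of_odd hodd, pi_pos]

open InnerProductGeometry in
lemma IsAnnularWalk.pi_le_of_mod_six {n : ℕ} [NeZero n] (hn3 : 3 ≤ n) (hn : n % 6 = 1 ∨ n % 6 = 3)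
    {d : ℝ} (hd0 : 0 ≤ d) (hd : d ≤ π / 12) {a : Fin n → ℂ}
    (ha : IsAnnularWalk (2 * sin (π / 6 + d)) a) : π ≤ 6 * d * (n - 1) := by
  have hpi := pi_pos
  obtain ⟨s, u, e, k, hs, hu0, hud, he, he', hang, hsum⟩ := ha.exists_signs hd0 hd
  have hn3' : (3 : ℝ) ≤ n := by exact_mod_cast hn3
  have hodd : Odd n := by rw [Nat.odd_iff]; omega
  by_cases hchange : ∃ i, s (i + 1) ≠ s i
  · obtain ⟨i, hi⟩ := hchange
    have h1 := sum_sign_mul_le hs hu0 hud he he' hi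
    have h2 := sum_sign_mul_le (s := fun i => -s i)
      (fun i => by rcases hs i with h | h <;> simp [h])
      hu0 hud he he' (i := i) (by simpa using hi)
    simp only [Int.cast_neg, neg_mul, Finset.sum_neg_distrib] at h2
    have h := abs_le.2 ⟨by linarith, h1⟩
    have hodd : Odd (6 * k - ∑ i, s i) :=
      ((by decide : Even (6 : ℤ)).mul_right k).sub_odd
        (odd_sum_of_forall_eq_one_or_neg_one hodd hs)
    rw [hsum, abs_mul, abs_of_pos (by positivity)] at h
    nlinarith [one_le_abs_of_odd hodd]
  · push Not at hchange
    have hconst := eq_apply_zero_of_succ_eq hchange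
    obtain ⟨l, hl⟩ : ∃ l : ℤ, ∑ i, e i = π / 3 * (6 * l - n : ℤ) := by
      simp only [hconst, ← Finset.mul_sum] at hsum
      rcases hs 0 with h | h
      · exact ⟨k, by simpa [h] using hsum⟩
      · refine ⟨-k, ?_⟩
        simp [h] at hsum
        push_cast
        linarith
    have h := abs_sum_sign_mul_le (s := fun _ : Fin n => 1) (by simp) (e := e) (d := d)
      fun i => abs_le.2
        ⟨by linarith [he i, hud i, hud (i + 1)], by linarith [he' i, hu0 i, hu0 (i + 1)]⟩
    simp only [Int.cast_one, one_mul] at h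
    by_cases hl1 : 6 * l - (n : ℤ) = -1
    · have hn7 : (7 : ℝ) ≤ n := by exact_mod_cast (by omega : 7 ≤ n)
      rw [hl1] at hl
      obtain ⟨i, -, hi⟩ : ∃ i ∈ Finset.univ, e i ≤ -(π / (3 * n)) := by
        refine Finset.exists_le_of_sum_le Finset.univ_nonempty ?_
        rw [hl]
        simp
        field_simp
        rfl
      by_contra! hlt
      have hR : 2 * sin (π / 6 + d) ≤ 3 / 2 := by
        have h1 : sin (π / 6 + d) ≤ sin (π / 4) :=
          sin_le_sin_of_le_of_le_pi_div_two (by linarith) (by linarith) (by linarith)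
        rw [sin_pi_div_four] at h1
        have : √2 ≤ 3 / 2 := by rw [sqrt_le_left (by norm_num)]; norm_num
        linarith
      have h1 := cos_angle_le hR (ha (i + 1)).1.1 (ha i).1.1 (ha (i + 1)).1.2 (ha i).1.2 (ha i).2.1
      set B := π / 6 * (((n : ℝ) - 1) / n) with hB
      have hB0 : 0 < B := mul_pos (by positivity) (div_pos (by linarith) (by linarith))
      have hB2 : 2 * B = π / 3 - π / (3 * n) := by
        rw [hB]
        field_simp
        ring
      have hB1 : 2 * B ≤ π / 3 := by rw [hB2]; linarith [show 0 ≤ π / (3 * (n : ℝ)) by positivity]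
      have h2 : cos (2 * B) ≤ cos (angle (a (i + 1)) (a i)) :=
        cos_le_cos_of_nonneg_of_le_pi (angle_nonneg _ _) (by linarith) (by linarith [hang i])
      rw [cos_two_mul, cos_sq'] at h2
      have hd1 : d < π / 6 / (n - 1) := by rw [lt_div_iff₀ (by linarith)]; linarith
      have hA : π / 6 * ((n : ℝ) / (n - 1)) = π / 6 + π / 6 / (n - 1) := by
        have : (n : ℝ) - 1 ≠ 0 := by linarith
        field_simp
        ring
      have hA1 : π / 6 / ((n : ℝ) - 1) ≤ π / 6 := div_le_self (by positivity) (by linarith)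
      have h3 := four_mul_sin_mul_sin_le_one hn7
      rw [← hB, hA] at h3
      have h4 : sin (π / 6 + d) < sin (π / 6 + π / 6 / (n - 1)) :=
        sin_lt_sin_of_lt_of_le_pi_div_two (by linarith) (by linarith) (by linarith)
      have hsB : 0 < sin B := sin_pos_of_pos_of_lt_pi hB0 (by linarith)
      have hsd : 0 < sin (π / 6 + d) := sin_pos_of_pos_of_lt_pi (by linarith) (by linarith)
      have h5 : 1 ≤ (4 * sin (π / 6 + d) * sin B) ^ 2 := by
        nlinarith [mul_le_mul_of_nonneg_left h2 (sq_nonneg (sin (π / 6 + d)))]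
      have h6 : 4 * sin (π / 6 + d) * sin B < 1 :=
        (mul_lt_mul_of_pos_right (by linarith) hsB).trans_le h3
      have h7 : 0 < 4 * sin (π / 6 + d) * sin B := by positivity
      nlinarith
    · have h3 : 3 ≤ |6 * l - (n : ℤ)| := by
        rw [le_abs]
        omega
      have h3' : (3 : ℝ) ≤ |((6 * l - n : ℤ) : ℝ)| := by exact_mod_cast h3
      rw [hl, abs_mul, abs_of_pos (by positivity)] at h
      nlinarith

lemma exists_eq_two_mul_sin {R t : ℝ} (hR : 1 ≤ R) (ht : t ≤ π / 4) (h : R < 2 * sin t)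
    (ht0 : 0 ≤ t) : ∃ d, 0 ≤ d ∧ π / 6 + d < t ∧ R = 2 * sin (π / 6 + d) := by
  have hpi := pi_pos
  have hlt : arcsin (R / 2) < t := by
    rw [arcsin_lt_iff_lt_sin' ⟨by linarith, by linarith⟩]
    linarith
  refine ⟨arcsin (R / 2) - π / 6, ?_, by linarith, ?_⟩
  · rw [sub_nonneg, le_arcsin_iff_sin_le' ⟨by linarith, by linarith⟩, sin_pi_div_six]
    linarith
  · rw [add_sub_cancel, sin_arcsin (by linarith) (by linarith [sin_le_one t])]
    ring

lemma exists_isAnnularWalk_of_seq {n : ℕ} [NeZero n] {R : ℝ} (b : ℕ → ℂ)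
    (hb : ∀ i < n, 1 ≤ ‖b i‖ ∧ ‖b i‖ ≤ R)
    (hstep : ∀ i, i + 1 < n → 1 ≤ ‖b (i + 1) - b i‖ ∧ ‖b (i + 1) - b i‖ ≤ R)
    (hlast : 1 ≤ ‖b 0 - b (n - 1)‖ ∧ ‖b 0 - b (n - 1)‖ ≤ R) :
    ∃ a : Fin n → ℂ, IsAnnularWalk R a := by
  obtain ⟨m, rfl⟩ := Nat.exists_eq_succ_of_ne_zero (NeZero.ne n)
  refine ⟨fun i => b i, fun i => ⟨hb i i.isLt, ?_⟩⟩
  induction i using Fin.lastCases with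
  | last => simpa using hlast
  | cast i =>
    rw [Fin.coeSucc_eq_succ]
    exact hstep i (Nat.succ_lt_succ i.isLt)

lemma norm_exp_sub_exp (x y : ℝ) :
    ‖Complex.exp (x * Complex.I) - Complex.exp (y * Complex.I)‖ = 2 * |sin ((x - y) / 2)| := by
  have : Complex.exp (x * Complex.I) - Complex.exp (y * Complex.I) =
      Complex.exp (y * Complex.I) * (Complex.exp (Complex.I * (x - y : ℝ)) - 1) := by
    rw [mul_sub, ← Complex.exp_add, mul_one]
    push_cast
    ring_nf
  rw [this, norm_mul, Complex.norm_exp_ofReal_mul_I, one_mul,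
    Complex.norm_exp_I_mul_ofReal_sub_one, norm_mul]
  simp

lemma exp_add_nat_mul_two_pi (x : ℝ) (m : ℕ) :
    Complex.exp ((x + m * (2 * π) : ℝ) * Complex.I) = Complex.exp (x * Complex.I) := by
  rw [Complex.exp_eq_exp_iff_exists_int]
  exact ⟨m, by push_cast; ring⟩

lemma norm_exp_step {t : ℝ} (ht : 0 ≤ sin t) (i : ℕ) :
    ‖Complex.exp ((2 * t * (i + 1 : ℕ) : ℝ) * Complex.I) -
      Complex.exp ((2 * t * i : ℝ) * Complex.I)‖ = 2 * sin t := by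
  rw [norm_exp_sub_exp, ← abs_of_nonneg ht]
  push_cast
  ring_nf

lemma exists_isAnnularWalk_of_even {n : ℕ} [NeZero n] (hn : Even n) :
    ∃ a : Fin n → ℂ, IsAnnularWalk 1 a := by
  have hpi := pi_pos
  have h : ‖Complex.exp ((π / 3 : ℝ) * Complex.I) - 1‖ = 1 := by
    have := norm_exp_sub_exp (π / 3) 0
    rw [show (π / 3 - 0) / 2 = π / 6 by ring, sin_pi_div_six] at this
    simpa using this
  have h' := norm_sub_rev (1 : ℂ) _ ▸ h
  refine exists_isAnnularWalk_of_seq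
    (fun i => if Even i then 1 else Complex.exp ((π / 3 : ℝ) * Complex.I)) ?_ ?_ ?_
  · intro i _
    split_ifs <;> simp [Complex.norm_exp_ofReal_mul_I, -Complex.ofReal_div]
  · intro i _
    by_cases hi : Even i <;> simp only [hi, Nat.even_add_one, not_true, not_false_eq_true, if_true,
      if_false, h, h', le_refl, and_self]
  · have : ¬ Even (n - 1) := by
      have := NeZero.pos n
      rw [Nat.even_iff] at hn ⊢
      omega
    simp only [this, Even.zero, if_true, if_false, h', le_refl, and_self]

lemma exists_isAnnularWalk_of_mod_six_eq_five {n : ℕ} [NeZero n] (hn : n % 6 = 5) :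
    ∃ a : Fin n → ℂ, IsAnnularWalk (2 * sin (π / 6 * ((n + 1) / n))) a := by
  have hpi := pi_pos
  set t := π / 6 * (((n : ℝ) + 1) / n) with ht
  have hn0 : (1 : ℝ) ≤ n := by exact_mod_cast NeZero.pos n
  have ht1 : π / 6 ≤ t :=
    le_mul_of_one_le_right (by positivity) ((one_le_div (by positivity)).2 (by linarith))
  have ht2 : t ≤ π / 6 * 2 :=
    mul_le_mul_of_nonneg_left ((div_le_iff₀ (by positivity)).2 (by linarith)) (by positivity)
  have hs : 1 / 2 ≤ sin t := by
    rw [← sin_pi_div_six]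
    exact sin_le_sin_of_le_of_le_pi_div_two (by linarith) (by linarith) ht1
  have hstep := norm_exp_step (t := t) (by linarith)
  refine exists_isAnnularWalk_of_seq (fun i => Complex.exp ((2 * t * i : ℝ) * Complex.I)) ?_ ?_ ?_
  · intro i _
    rw [Complex.norm_exp_ofReal_mul_I]
    exact ⟨le_rfl, by linarith⟩
  · intro i _
    rw [hstep]
    exact ⟨by linarith, le_rfl⟩
  · have hclose : Complex.exp ((2 * t * (0 : ℕ) : ℝ) * Complex.I) =
        Complex.exp ((2 * t * (n - 1 + 1 : ℕ) : ℝ) * Complex.I) := by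
      rw [Nat.sub_add_cancel NeZero.one_le, ← exp_add_nat_mul_two_pi _ (n / 6 + 1)]
      congr 3
      have : (n : ℝ) = 6 * (n / 6 : ℕ) + 5 := by exact_mod_cast (by omega : n = 6 * (n / 6) + 5)
      have htn : 2 * t * n = π / 3 * (n + 1) := by
        rw [ht]
        field_simp
        ring
      push_cast
      linear_combination -htn - π / 3 * this
    rw [hclose, hstep]
    exact ⟨by linarith, le_rfl⟩

lemma pi_div_six_mul_bounds {x : ℝ} (hx : 3 ≤ x) :
    π / 6 ≤ π / 6 * (x / (x - 1)) ∧ π / 6 * (x / (x - 1)) ≤ π / 4 := by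
  have hpi := pi_pos
  refine ⟨le_mul_of_one_le_right (by positivity) ((one_le_div (by linarith)).2 (by linarith)), ?_⟩
  calc π / 6 * (x / (x - 1)) ≤ π / 6 * (3 / 2) :=
        mul_le_mul_of_nonneg_left ((div_le_iff₀ (by linarith)).2 (by linarith)) (by positivity)
    _ = π / 4 := by ring

lemma exists_isAnnularWalk_of_mod_six {n : ℕ} [NeZero n] (hn3 : 3 ≤ n)
    (hn : n % 6 = 1 ∨ n % 6 = 3) :
    ∃ a : Fin n → ℂ, IsAnnularWalk (2 * sin (π / 6 * (n / (n - 1)))) a := by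
  have hpi := pi_pos
  have hn3' : (3 : ℝ) ≤ n := by exact_mod_cast hn3
  have hn1 : (n : ℝ) - 1 ≠ 0 := by linarith
  obtain ⟨ht1, ht2⟩ := pi_div_six_mul_bounds hn3'
  set t := π / 6 * ((n : ℝ) / (n - 1)) with ht
  have htn : 2 * t * (n - 1) = π / 3 * n := by
    rw [ht]
    field_simp
    ring
  have hs : 1 / 2 ≤ sin t := by
    rw [← sin_pi_div_six]
    exact sin_le_sin_of_le_of_le_pi_div_two (by linarith) (by linarith) ht1
  have hstep := norm_exp_step (t := t) (by linarith)
  rcases hn with hn | hn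
  · refine exists_isAnnularWalk_of_seq (fun i => Complex.exp ((2 * t * i : ℝ) * Complex.I)) ?_ ?_ ?_
    · intro i _
      rw [Complex.norm_exp_ofReal_mul_I]
      exact ⟨le_rfl, by linarith⟩
    · intro i _
      rw [hstep]
      exact ⟨by linarith, le_rfl⟩
    · have hclose : 2 * t * (n - 1 : ℕ) = π / 3 + (n / 6 : ℕ) * (2 * π) := by
        have : (n : ℝ) = 6 * (n / 6 : ℕ) + 1 := by exact_mod_cast (by omega : n = 6 * (n / 6) + 1)
        rw [Nat.cast_sub NeZero.one_le, Nat.cast_one, htn]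
        linear_combination π / 3 * this
      rw [hclose, exp_add_nat_mul_two_pi, norm_exp_sub_exp,
        show (2 * t * (0 : ℕ) - π / 3) / 2 = -(π / 6) by simp; ring, sin_neg, abs_neg,
        sin_pi_div_six, abs_of_pos (by norm_num)]
      exact ⟨by norm_num, by linarith⟩
  · have hclose : 2 * t * (n - 2 : ℕ) = (-(2 * t) + π) + (n / 6 : ℕ) * (2 * π) := by
      have : (n : ℝ) = 6 * (n / 6 : ℕ) + 3 := by exact_mod_cast (by omega : n = 6 * (n / 6) + 3)
      have h2 : 2 * t * (n - 2) = -(2 * t) + π / 3 * n := by linear_combination htn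
      rw [Nat.cast_sub (by omega), Nat.cast_ofNat, h2]
      linear_combination π / 3 * this
    have hexp : Complex.exp ((2 * t * (n - 2 : ℕ) : ℝ) * Complex.I) =
        -Complex.exp ((-(2 * t) : ℝ) * Complex.I) := by
      rw [hclose, exp_add_nat_mul_two_pi]
      push_cast
      rw [add_mul, Complex.exp_add, Complex.exp_pi_mul_I]
      ring
    have hnorm : ‖1 + Complex.exp ((2 * t * (n - 2 : ℕ) : ℝ) * Complex.I)‖ = 2 * sin t := by
      have h := norm_exp_sub_exp 0 (-(2 * t))
      rw [show (0 - -(2 * t)) / 2 = t by ring, abs_of_nonneg (by linarith)] at h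
      rw [hexp, ← h]
      simp [sub_eq_add_neg]
    refine exists_isAnnularWalk_of_seq (fun i => if i < n - 1
      then Complex.exp ((2 * t * i : ℝ) * Complex.I)
      else 1 + Complex.exp ((2 * t * (n - 2 : ℕ) : ℝ) * Complex.I)) ?_ ?_ ?_
    · intro i _
      split_ifs
      · rw [Complex.norm_exp_ofReal_mul_I]
        exact ⟨le_rfl, by linarith⟩
      · rw [hnorm]
        exact ⟨by linarith, le_rfl⟩
    · intro i hi
      rw [if_pos (by omega : i < n - 1)]
      split_ifs with h
      · rw [hstep]
        exact ⟨by linarith, le_rfl⟩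
      · obtain rfl : i = n - 2 := by omega
        rw [add_sub_cancel_right, norm_one]
        exact ⟨le_rfl, by linarith⟩
    · rw [if_pos (by omega : 0 < n - 1), if_neg (lt_irrefl _)]
      have h : Complex.exp ((2 * t * (0 : ℕ) : ℝ) * Complex.I) = 1 := by simp
      rw [h, sub_add_cancel_left, norm_neg, Complex.norm_exp_ofReal_mul_I]
      exact ⟨le_rfl, by linarith⟩

open scoped Classical in
theorem prism_flow_number (n : ℕ) (hn : 3 ≤ n) :
    IsLeast {r : ℝ | HasComplexNZFlow ((cycleGraph n).boxProd (completeGraph (Fin 2))) r}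
      (if Even n then 2
       else if n % 6 = 5 then 1 + 2 * Real.sin (Real.pi / 6 * (((n : ℝ) + 1) / (n : ℝ)))
       else 1 + 2 * Real.sin (Real.pi / 6 * ((n : ℝ) / ((n : ℝ) - 1)))) := by
  have hpi := pi_pos
  have : NeZero n := ⟨by omega⟩
  have hn3 : (3 : ℝ) ≤ n := by exact_mod_cast hn
  have hset : {r : ℝ | HasComplexNZFlow ((cycleGraph n).boxProd (completeGraph (Fin 2))) r} =
      {r | ∃ a : Fin n → ℂ, IsAnnularWalk (r - 1) a} :=
    Set.ext fun r => hasComplexNZFlow_prismGraph_iff hn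
  rw [hset]
  split_ifs with heven h5
  · refine ⟨?_, ?_⟩
    · rw [Set.mem_ofPred_eq, show (2 : ℝ) - 1 = 1 by norm_num]
      exact exists_isAnnularWalk_of_even heven
    · rintro r ⟨a, ha⟩
      linarith [(ha 0).1.1, (ha 0).1.2]
  · refine ⟨?_, ?_⟩
    · rw [Set.mem_ofPred_eq, add_sub_cancel_left]
      exact exists_isAnnularWalk_of_mod_six_eq_five h5
    · rintro r ⟨a, ha⟩
      by_contra! hlt
      have ht : π / 6 * (((n : ℝ) + 1) / n) = π / 6 + π / 6 / n := by
        field_simp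
      have ht' : π / 6 / (n : ℝ) ≤ π / 12 := by
        rw [div_le_iff₀ (by linarith)]
        nlinarith
      rw [ht] at hlt
      obtain ⟨d, hd0, hd, hR⟩ := exists_eq_two_mul_sin (t := π / 6 + π / 6 / n)
        ((ha 0).1.1.trans (ha 0).1.2) (by linarith) (by linarith) (by positivity)
      rw [hR] at ha
      have := ha.pi_le_of_odd (Nat.not_even_iff_odd.1 heven) hd0 (by linarith)
      have hd' : d < π / 6 / n := by linarith
      rw [lt_div_iff₀ (by linarith)] at hd'
      linarith
  · have hmod : n % 6 = 1 ∨ n % 6 = 3 := by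
      rw [Nat.even_iff] at heven
      omega
    refine ⟨?_, ?_⟩
    · rw [Set.mem_ofPred_eq, add_sub_cancel_left]
      exact exists_isAnnularWalk_of_mod_six hn hmod
    · rintro r ⟨a, ha⟩
      by_contra! hlt
      obtain ⟨ht1, ht2⟩ := pi_div_six_mul_bounds hn3
      obtain ⟨d, hd0, hd, hR⟩ := exists_eq_two_mul_sin ((ha 0).1.1.trans (ha 0).1.2)
        ht2 (by linarith) (by linarith)
      rw [hR] at ha
      have := ha.pi_le_of_mod_six hn hmod hd0 (by linarith)
      have ht : π / 6 * ((n : ℝ) / (n - 1)) = π / 6 + π / 6 / (n - 1) := by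
        have : (n : ℝ) - 1 ≠ 0 := by linarith
        field_simp
        ring
      have hd' : d < π / 6 / (n - 1) := by linarith
      rw [lt_div_iff₀ (by linarith)] at hd'
      linarith
end

section
/- For every real number λ with 1 < λ ≤ √2, one has arcsin(1/(2λ)) + arcsin(λ/2) > π/3. -/
open Real

theorem arcsin_sum_gt (l : ℝ) (h1 : 1 < l) (h2 : l ≤ Real.sqrt 2) :
    Real.pi / 3 < Real.arcsin (1 / (2 * l)) + Real.arcsin (l / 2) := by
  have hl : 0 < l := by linarith
  have hl2 : l ^ 2 ≤ 2 := (Real.le_sqrt hl.le (by norm_num)).1 h2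
  have hl_le : l ≤ 2 := by nlinarith
  have hx0 : 0 < 1 / (2 * l) := by positivity
  have hx1 : 1 / (2 * l) ≤ 1 := by
    rw [div_le_one (by positivity)]
    linarith
  have hprod : √(1 - (1 / (2 * l)) ^ 2) * √(1 - (l / 2) ^ 2) < 3 / 4 := by
    rw [← Real.sqrt_mul (by nlinarith), Real.sqrt_lt' (by norm_num)]
    have hsub : (3 / 4 : ℝ) ^ 2 - (1 - (1 / (2 * l)) ^ 2) * (1 - (l / 2) ^ 2)
        = ((l ^ 2 - 1) / (2 * l)) ^ 2 := by
      field_simp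
      ring
    have hpos : 0 < ((l ^ 2 - 1) / (2 * l)) ^ 2 :=
      pow_pos (div_pos (by nlinarith) (by positivity)) 2
    linarith
  by_contra! h
  have hcos := Real.cos_le_cos_of_nonneg_of_le_pi
    (add_nonneg (Real.arcsin_nonneg.2 hx0.le) (Real.arcsin_nonneg.2 (by positivity)))
    (by linarith [Real.pi_pos]) h
  rw [Real.cos_pi_div_three, Real.cos_add, Real.cos_arcsin, Real.cos_arcsin,
    Real.sin_arcsin (by linarith) hx1, Real.sin_arcsin (by linarith) (by linarith)] at hcos
  have hmul : 1 / (2 * l) * (l / 2) = 1 / 4 := by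
    field_simp
    norm_num
  linarith
end

section
/- For every real number λ with 1 < λ ≤ √2, one has 2·arcsin(1/(2λ)) - arcsin(λ/2) < π/6. -/
open Real

theorem arcsin_diff_lt (l : ℝ) (h1 : 1 < l) (h2 : l ≤ Real.sqrt 2) :
    2 * Real.arcsin (1 / (2 * l)) - Real.arcsin (l / 2) < Real.pi / 6 := by
  have hπ := Real.pi_pos
  have hα : Real.arcsin (1 / (2 * l)) < Real.pi / 6 := by
    rw [Real.arcsin_lt_iff_lt_sin' ⟨by linarith, by linarith⟩, Real.sin_pi_div_six]
    exact one_div_lt_one_div_of_lt two_pos (by linarith)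
  have hβ : Real.pi / 6 ≤ Real.arcsin (l / 2) := by
    rw [Real.le_arcsin_iff_sin_le' ⟨by linarith, by linarith⟩, Real.sin_pi_div_six]
    linarith
  linarith
end

section
/- Let λ be a real number with λ ≤ √2 and let p, q ∈ ℂ satisfy 1 ≤ ‖p‖ ≤ λ, 1 ≤ ‖q‖ ≤ λ, and ‖p - q‖ ≥ 1. Then the angle between p and q (as vectors in the real inner product space ℂ, i.e. InnerProductGeometry.angle p q) is at least 2·arcsin(1/(2λ)). -/
open Real

theorem sq_mul_sub_sq_add_mul_le_sq_of_le {l a b : ℝ} (ha : 1 ≤ a) (hab : a ≤ b) (hb : b ≤ l)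
    (hl : l ^ 2 ≤ l + 1) : l ^ 2 * (a - b) ^ 2 + a * b ≤ l ^ 2 := by
  have hl0 : 0 ≤ l := by linarith
  have h1 : l * (l - a) ≤ 1 := by nlinarith
  have h2 : l * (b - a) ≤ 1 := le_trans (by gcongr) h1
  have h3 : (l * (b - a)) ^ 2 ≤ l * (b - a) := by
    have : 0 ≤ l * (b - a) := mul_nonneg hl0 (by linarith)
    nlinarith
  nlinarith [mul_nonneg (show 0 ≤ l + a by linarith) (show 0 ≤ l - b by linarith)]

theorem sq_mul_sub_sq_add_mul_le_sq {l a b : ℝ} (ha1 : 1 ≤ a) (ha2 : a ≤ l) (hb1 : 1 ≤ b)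
    (hb2 : b ≤ l) (hl : l ^ 2 ≤ l + 1) : l ^ 2 * (a - b) ^ 2 + a * b ≤ l ^ 2 := by
  rcases le_total a b with h | h
  · exact sq_mul_sub_sq_add_mul_le_sq_of_le ha1 h hb2 hl
  · linarith [sq_mul_sub_sq_add_mul_le_sq_of_le hb1 h ha2 hl]

theorem two_mul_arcsin_eq_arccos {x : ℝ} (hx0 : 0 ≤ x) (hx1 : x ≤ 1) :
    2 * arcsin x = arccos (1 - 2 * x ^ 2) := by
  have h0 : 0 ≤ 2 * arcsin x := by linarith [arcsin_nonneg.2 hx0]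
  have hpi : 2 * arcsin x ≤ π := by linarith [arcsin_le_pi_div_two x]
  rw [← arccos_cos h0 hpi, cos_two_mul_eq_one_sub, sin_arcsin (by linarith) hx1]

theorem angle_lower_bound (l : ℝ) (hl : l ≤ Real.sqrt 2) (p q : ℂ)
    (hp1 : 1 ≤ ‖p‖) (hp2 : ‖p‖ ≤ l) (hq1 : 1 ≤ ‖q‖) (hq2 : ‖q‖ ≤ l)
    (hpq : 1 ≤ ‖p - q‖) :
    2 * Real.arcsin (1 / (2 * l)) ≤ InnerProductGeometry.angle p q := by
  have hl1 : 1 ≤ l := hp1.trans hp2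
  have hl2 : l ^ 2 ≤ l + 1 := by
    have : l ^ 2 ≤ 2 := (Real.le_sqrt (by linarith) (by norm_num)).1 hl
    linarith
  have key := sq_mul_sub_sq_add_mul_le_sq hp1 hp2 hq1 hq2 hl2
  have hinner : 2 * inner ℝ p q ≤ ‖p‖ ^ 2 + ‖q‖ ^ 2 - 1 := by
    have := norm_sub_sq_real p q
    nlinarith
  rw [two_mul_arcsin_eq_arccos (by positivity) (by rw [div_le_one] <;> linarith),
    InnerProductGeometry.angle]
  apply Real.arccos_le_arccos
  have hpq0 : 0 < ‖p‖ * ‖q‖ := by positivity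
  rw [div_le_iff₀ hpq0]
  have hdiv : (‖p‖ - ‖q‖) ^ 2 + ‖p‖ * ‖q‖ / l ^ 2 ≤ 1 := by
    have hl0 : 0 < l ^ 2 := by positivity
    have : ‖p‖ * ‖q‖ / l ^ 2 ≤ 1 - (‖p‖ - ‖q‖) ^ 2 := by
      rw [div_le_iff₀ hl0]
      linarith
    linarith
  have hx : (1 - 2 * (1 / (2 * l)) ^ 2) * (‖p‖ * ‖q‖)
      = ‖p‖ * ‖q‖ - ‖p‖ * ‖q‖ / l ^ 2 / 2 := by
    field_simp
  rw [hx]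
  linarith
end

section
/- Let n ≥ 3 be an odd integer. Then the set {λ : ℝ | 1 < λ ∧ ∃ k : ℕ, 1 ≤ k ∧ k < n ∧ λ = 2·sin(k·π/n)} has least element 2·sin(⌈n/6⌉·π/n). -/
open Real

theorem sin_natCast_mul_pi_div_le {n a b : ℕ} (hab : a ≤ b) (hb : 2 * b ≤ n) :
    Real.sin ((a : ℝ) * Real.pi / (n : ℝ)) ≤ Real.sin ((b : ℝ) * Real.pi / (n : ℝ)) := by
  rcases Nat.eq_zero_or_pos n with rfl | hn
  · simp
  have hn' : (0 : ℝ) < n := by exact_mod_cast hn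
  have hpi := Real.pi_pos
  have hb' : 2 * (b : ℝ) ≤ n := by exact_mod_cast hb
  apply Real.sin_le_sin_of_le_of_le_pi_div_two
  · have : 0 ≤ (a : ℝ) * Real.pi / n := by positivity
    linarith
  · rw [div_le_iff₀ hn']
    nlinarith
  · gcongr

theorem one_lt_two_mul_sin_natCast_mul_pi_div {n a : ℕ} (h : n < 6 * a) (ha : 2 * a ≤ n) :
    1 < 2 * Real.sin ((a : ℝ) * Real.pi / (n : ℝ)) := by
  have hn' : (0 : ℝ) < n := by exact_mod_cast (by omega : 0 < n)
  have hpi := Real.pi_pos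
  have h' : (n : ℝ) < 6 * a := by exact_mod_cast h
  have ha' : 2 * (a : ℝ) ≤ n := by exact_mod_cast ha
  have key : Real.sin (Real.pi / 6) < Real.sin ((a : ℝ) * Real.pi / n) := by
    apply Real.sin_lt_sin_of_lt_of_le_pi_div_two
    · linarith
    · rw [div_le_iff₀ hn']
      nlinarith
    · rw [lt_div_iff₀ hn']
      nlinarith
  rw [Real.sin_pi_div_six] at key
  linarith

theorem lt_six_mul_of_one_lt_two_mul_sin {n a : ℕ} (hn : 0 < n)
    (h : 1 < 2 * Real.sin ((a : ℝ) * Real.pi / (n : ℝ))) : n < 6 * a := by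
  by_contra! hle
  have hn' : (0 : ℝ) < n := by exact_mod_cast hn
  have hpi := Real.pi_pos
  have hle' : 6 * (a : ℝ) ≤ n := by exact_mod_cast hle
  have key : Real.sin ((a : ℝ) * Real.pi / n) ≤ Real.sin (Real.pi / 6) := by
    apply Real.sin_le_sin_of_le_of_le_pi_div_two
    · have : 0 ≤ (a : ℝ) * Real.pi / n := by positivity
      linarith
    · linarith
    · rw [div_le_iff₀ hn']
      nlinarith
  rw [Real.sin_pi_div_six] at key
  linarith

theorem exists_two_mul_le_sin_natCast_mul_pi_div_eq {n k : ℕ} (hk : k < n) :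
    ∃ j : ℕ, 2 * j ≤ n ∧
      Real.sin ((k : ℝ) * Real.pi / (n : ℝ)) = Real.sin ((j : ℝ) * Real.pi / (n : ℝ)) := by
  rcases le_total (2 * k) n with h | h
  · exact ⟨k, h, rfl⟩
  · refine ⟨n - k, by omega, ?_⟩
    have hn' : (n : ℝ) ≠ 0 := by exact_mod_cast (by omega : n ≠ 0)
    rw [← Real.sin_pi_sub, Nat.cast_sub hk.le]
    congr 1
    field_simp

theorem least_sin_multiple (n : ℕ) (hn : 3 ≤ n) (hodd : Odd n) :
    IsLeast {l : ℝ | 1 < l ∧ ∃ k : ℕ, 1 ≤ k ∧ k < n ∧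
        l = 2 * Real.sin ((k : ℝ) * Real.pi / (n : ℝ))}
      (2 * Real.sin ((⌈(n : ℝ) / 6⌉ : ℝ) * Real.pi / (n : ℝ))) := by
  obtain ⟨m, hm₁, hm₂⟩ : ∃ m : ℕ, n < 6 * m ∧ 6 * m ≤ n + 5 := by
    obtain ⟨r, rfl⟩ := hodd
    exact ⟨(2 * r + 1 + 5) / 6, by omega, by omega⟩
  have hceil : ⌈(n : ℝ) / 6⌉ = (m : ℤ) := by
    have h₁ : (n : ℝ) < 6 * m := by exact_mod_cast hm₁
    have h₂ : 6 * (m : ℝ) ≤ n + 5 := by exact_mod_cast hm₂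
    rw [Int.ceil_eq_iff]
    push_cast
    constructor <;> linarith
  rw [hceil, Int.cast_natCast]
  refine ⟨⟨one_lt_two_mul_sin_natCast_mul_pi_div hm₁ (by omega), m, by omega, by omega, rfl⟩, ?_⟩
  rintro _ ⟨hl, k, -, hkn, rfl⟩
  obtain ⟨j, hj, hkj⟩ := exists_two_mul_le_sin_natCast_mul_pi_div_eq hkn
  rw [hkj] at hl ⊢
  have hnj := lt_six_mul_of_one_lt_two_mul_sin (by omega) hl
  linarith [sin_natCast_mul_pi_div_le (a := m) (b := j) (by omega) hj]
end

section
/- Let n ≥ 7 be an odd integer and set t = ⌊n/6⌋. If n ≡ 1 (mod 6) or n ≡ 3 (mod 6), then 1/(2·sin(t·π/n)) > 2·sin((π/6)·(n/(n-1))); if n ≡ 5 (mod 6), then 1/(2·sin(t·π/n)) > 2·sin((π/6)·((n+1)/n)). -/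
open Real

/-- With `y = π / (6 n (n - 1))` and `x ^ 2 = y * (4 * (π / 6) + y)`, this inequality bounds the
Taylor remainders in `cos x - cos (π / 3 + y) < 1 / 2`. -/
lemma sqrt_three_mul_lt_of_small {y : ℝ} (hy : 0 < y) (hy' : y ≤ 1 / 50) :
    y ^ 2 / 4 + √3 / 2 * y + 5 / 96 * (y * (4 * (π / 6) + y)) ^ 2 <
      y * (4 * (π / 6) + y) / 2 := by
  have hpi := Real.pi_gt_d2
  have hpi' := Real.pi_lt_d2
  have hs : √3 < 1.74 := by
    rw [Real.sqrt_lt' (by norm_num)]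
    norm_num
  have hu : (4 * (π / 6) + y) ^ 2 ≤ 5 := by nlinarith
  have hyu : y * (4 * (π / 6) + y) ^ 2 ≤ 1 / 50 * 5 :=
    mul_le_mul hy' hu (sq_nonneg _) (by norm_num)
  have key : y / 4 + √3 / 2 + 5 / 96 * (y * (4 * (π / 6) + y) ^ 2) <
      (4 * (π / 6) + y) / 2 := by linarith
  have := mul_lt_mul_of_pos_left key hy
  linarith

lemma four_mul_sin_mul_sin_lt_one {n : ℝ} (hn : 7 ≤ n) :
    4 * (sin (π / 6 * (n / (n - 1))) * sin (π / 6 * ((n - 1) / n))) < 1 := by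
  have hpi := Real.pi_gt_d2
  have hpi' := Real.pi_lt_d2
  have hn0 : n ≠ 0 := by linarith
  have hn1 : n - 1 ≠ 0 := by linarith
  set y := π / 6 * (1 / (n * (n - 1))) with hydef
  set x := π / 6 * (n / (n - 1)) - π / 6 * ((n - 1) / n) with hxdef
  have hm : 42 ≤ n * (n - 1) := by nlinarith
  have hy : 0 < y := by positivity
  have hy' : y ≤ 1 / 50 := by
    rw [hydef, mul_one_div, div_le_iff₀ (by linarith)]
    linarith
  have hx2 : x ^ 2 = y * (4 * (π / 6) + y) := by
    rw [hxdef, hydef]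
    field_simp
    ring
  have hsum : π / 6 * (n / (n - 1)) + π / 6 * ((n - 1) / n) = π / 3 + y := by
    rw [hydef]
    field_simp
    ring
  have hx1 : |x| ≤ 1 := by
    rw [← sq_le_one_iff_abs_le_one, hx2]
    nlinarith
  have hcosx := (abs_le.mp (Real.cos_bound hx1)).2
  have hx4 : |x| ^ 4 = (y * (4 * (π / 6) + y)) ^ 2 := by
    rw [← hx2, ← sq_abs x, ← pow_mul]
  have hcosy := Real.one_sub_sq_div_two_le_cos (x := y)
  have hsiny := Real.sin_le hy.le
  have hmain := sqrt_three_mul_lt_of_small hy hy'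
  have hcos : cos (π / 3 + y) = 1 / 2 * cos y - √3 / 2 * sin y := by
    rw [Real.cos_add, Real.cos_pi_div_three, Real.sin_pi_div_three]
  have hprod : √3 / 2 * sin y ≤ √3 / 2 * y := by gcongr
  have hprodsum := Real.two_mul_sin_mul_sin (π / 6 * (n / (n - 1))) (π / 6 * ((n - 1) / n))
  rw [← hxdef, hsum, hcos] at hprodsum
  rw [hx4, hx2] at hcosx
  linarith

lemma two_mul_sin_lt_one_div_two_mul_sin {n A B : ℝ} (hn : 7 ≤ n)
    (hA₀ : 0 ≤ A) (hA : A ≤ π / 6 * (n / (n - 1)))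
    (hB₀ : 0 < B) (hB : B ≤ π / 6 * ((n - 1) / n)) :
    2 * sin A < 1 / (2 * sin B) := by
  have hpi := Real.pi_pos
  have h₁ : n / (n - 1) ≤ 2 := by
    rw [div_le_iff₀ (by linarith)]
    linarith
  have h₂ : (n - 1) / n ≤ 1 := by
    rw [div_le_iff₀ (by linarith)]
    linarith
  have hA' : π / 6 * (n / (n - 1)) ≤ π / 2 := by nlinarith
  have hB' : π / 6 * ((n - 1) / n) ≤ π / 2 := by nlinarith
  have hsB : 0 < sin B := Real.sin_pos_of_pos_of_lt_pi hB₀ (by linarith)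
  have hsA : 0 ≤ sin A := Real.sin_nonneg_of_nonneg_of_le_pi hA₀ (by linarith)
  have hsA' := Real.sin_le_sin_of_le_of_le_pi_div_two (by linarith) hA' hA
  have hsB' := Real.sin_le_sin_of_le_of_le_pi_div_two (by linarith) hB' hB
  have hle := mul_le_mul hsA' hsB' hsB.le (hsA.trans hsA')
  rw [lt_div_iff₀ (by positivity)]
  linarith [four_mul_sin_mul_sin_lt_one hn]

theorem all_unit_vectors_case_not_optimal (n : ℕ) (hn : 7 ≤ n) (hodd : Odd n) :
    ((n % 6 = 1 ∨ n % 6 = 3) →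
      2 * Real.sin (Real.pi / 6 * ((n : ℝ) / ((n : ℝ) - 1))) <
        1 / (2 * Real.sin ((⌊(n : ℝ) / 6⌋ : ℝ) * Real.pi / (n : ℝ)))) ∧
    (n % 6 = 5 →
      2 * Real.sin (Real.pi / 6 * (((n : ℝ) + 1) / (n : ℝ))) <
        1 / (2 * Real.sin ((⌊(n : ℝ) / 6⌋ : ℝ) * Real.pi / (n : ℝ)))) := by
  have hn' : (7 : ℝ) ≤ n := by exact_mod_cast hn
  have hn1 : (0 : ℝ) < n - 1 := by linarith
  have hpi := Real.pi_pos
  have hfloor : ⌊(n : ℝ) / 6⌋ = ((n / 6 : ℕ) : ℤ) := by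
    rw [Int.floor_eq_iff, Int.cast_natCast]
    have h₁ : ((6 * (n / 6) : ℕ) : ℝ) ≤ n := by exact_mod_cast Nat.mul_div_le n 6
    have h₂ : (n : ℝ) < ((6 * (n / 6) + 6 : ℕ) : ℝ) := by
      exact_mod_cast (by omega : n < 6 * (n / 6) + 6)
    push_cast at h₁ h₂
    constructor <;> linarith
  have hpos : (1 : ℝ) ≤ (⌊(n : ℝ) / 6⌋ : ℝ) := by
    rw [hfloor]
    exact_mod_cast (by omega : 1 ≤ n / 6)
  have hle : 6 * (⌊(n : ℝ) / 6⌋ : ℝ) ≤ n - 1 := by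
    rw [hfloor, le_sub_iff_add_le]
    obtain ⟨k, hk⟩ := hodd
    exact_mod_cast (by omega : 6 * (n / 6) + 1 ≤ n)
  have hB₀ : 0 < (⌊(n : ℝ) / 6⌋ : ℝ) * π / n := by positivity
  have hB : (⌊(n : ℝ) / 6⌋ : ℝ) * π / n ≤ π / 6 * (((n : ℝ) - 1) / n) := by
    rw [← mul_div_assoc]
    refine div_le_div_of_nonneg_right ?_ (by linarith)
    nlinarith
  refine ⟨fun _ => two_mul_sin_lt_one_div_two_mul_sin hn' (by positivity) le_rfl hB₀ hB,
    fun _ => two_mul_sin_lt_one_div_two_mul_sin hn' (by positivity) ?_ hB₀ hB⟩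
  gcongr π / 6 * ?_
  rw [div_le_div_iff₀ (by linarith) hn1]
  linarith
end
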